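/- There exists a rest-point free flow on ℝ³ with uniformly bounded trajectories: a continuous map φ : ℝ × ℝ³ → ℝ³ with φ(0,x) = x and φ(s+t,x) = φ(s,φ(t,x)) for all s, t ∈ ℝ and x ∈ ℝ³, such that for every x ∈ ℝ³ there exists t ∈ ℝ with φ(t,x) ≠ x, and there exists a constant K > 0 such that ‖φ(t,x) − x‖ ≤ K for all t ∈ ℝ and x ∈ ℝ³. (Kuperberg–Reed solution to Ulam's Problem 110 from the Scottish Book.) -/

import Mathlib

open Set Filter Topology
open scoped NNReal

namespace KR

section flow
variable {E : Type*} [NormedAddCommGroup E] [NormedSpace ℝ E]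

lemma sol_unique {V : E → E} {K : ℝ≥0} (hK : LipschitzWith K V) {f g : ℝ → E} {a b t₀ : ℝ}
    (ht : t₀ ∈ Ioo a b)
    (hf : ∀ t ∈ Ioo a b, HasDerivAt f (V (f t)) t)
    (hg : ∀ t ∈ Ioo a b, HasDerivAt g (V (g t)) t) (h : f t₀ = g t₀) : EqOn f g (Ioo a b) :=
  ODE_solution_unique_of_mem_Ioo (v := fun _ => V) (s := fun _ => univ) (K := K)
    (fun _ _ => hK.lipschitzOnWith) ht (fun t h => ⟨hf t h, trivial⟩)
    (fun t h => ⟨hg t h, trivial⟩) h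

lemma sol_dist_pos {V : E → E} {K : ℝ≥0} (hK : LipschitzWith K V) {f g : ℝ → E}
    (hf : ∀ t, HasDerivAt f (V (f t)) t)
    (hg : ∀ t, HasDerivAt g (V (g t)) t) {t : ℝ} (ht : 0 ≤ t) :
    dist (f t) (g t) ≤ dist (f 0) (g 0) * Real.exp (K * t) := by
  have := dist_le_of_trajectories_ODE (v := fun _ => V) (K := K) (a := 0) (b := t) (fun _ => hK)
    (fun s _ => (hf s).continuousAt.continuousWithinAt) (fun s _ => (hf s).hasDerivWithinAt)
    (fun s _ => (hg s).continuousAt.continuousWithinAt) (fun s _ => (hg s).hasDerivWithinAt)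
    le_rfl t ⟨ht, le_rfl⟩
  simpa using this

lemma sol_neg {V : E → E} {f : ℝ → E} (hf : ∀ t, HasDerivAt f (V (f t)) t) (t : ℝ) :
    HasDerivAt (fun s => f (-s)) ((fun x => - V x) (f (-t))) t := by
  have := (hf (-t)).scomp t (hasDerivAt_neg t)
  simpa [Function.comp_def] using this

lemma sol_dist {V : E → E} {K : ℝ≥0} (hK : LipschitzWith K V) {f g : ℝ → E}
    (hf : ∀ t, HasDerivAt f (V (f t)) t)
    (hg : ∀ t, HasDerivAt g (V (g t)) t) (t : ℝ) :
    dist (f t) (g t) ≤ dist (f 0) (g 0) * Real.exp (K * |t|) := by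
  rcases le_total 0 t with h | h
  · rw [abs_of_nonneg h]; exact sol_dist_pos hK hf hg h
  · rw [abs_of_nonpos h]
    have := sol_dist_pos (V := fun x => - V x) hK.neg (f := fun s => f (-s)) (g := fun s => g (-s))
      (sol_neg hf) (sol_neg hg) (t := -t) (by linarith)
    simpa using this

theorem flow_exists [CompleteSpace E] (V : E → E) (K L : ℝ≥0) (hK : LipschitzWith K V)
    (hL : ∀ x, ‖V x‖ ≤ L) :
    ∃ Φ : ℝ × E → E, Continuous Φ ∧ (∀ x, Φ (0, x) = x) ∧
      (∀ s t x, Φ (s + t, x) = Φ (s, Φ (t, x))) ∧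
      ∀ x t, HasDerivAt (fun s => Φ (s, x)) (V (Φ (t, x))) t := by
  have h1 : ∀ (x : E) (n : ℕ), ∃ α : ℝ → E, α 0 = x ∧
      ∀ t ∈ Ioo (-((n : ℝ) + 1)) (n + 1), HasDerivAt α (V (α t)) t := by
    intro x n
    have hn : (0 : ℝ) ≤ (n : ℝ) + 1 := by positivity
    have hP : IsPicardLindelof (fun _ => V) (tmin := -((n : ℝ) + 1)) (tmax := n + 1)
        ⟨0, by constructor <;> linarith⟩ x (L * (n + 1)) 0 L K :=
      { lipschitzOnWith := fun _ _ => hK.lipschitzOnWith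
        continuousOn := fun _ _ => continuousOn_const
        norm_le := fun _ _ x _ => hL x
        mul_max_le := by simp }
    obtain ⟨α, h0, hα⟩ := hP.exists_eq_forall_mem_Icc_hasDerivWithinAt₀
    exact ⟨α, h0, fun t ht => (hα t ⟨ht.1.le, ht.2.le⟩).hasDerivAt (Icc_mem_nhds ht.1 ht.2)⟩
  choose α hα0 hα using h1
  have h2 : ∀ x (n m : ℕ), n ≤ m → EqOn (α x n) (α x m) (Ioo (-((n : ℝ) + 1)) (n + 1)) := by
    intro x n m hnm
    have hn : (0 : ℝ) ≤ (n : ℝ) := by positivity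
    have : (n : ℝ) ≤ m := by exact_mod_cast hnm
    refine sol_unique hK (t₀ := 0) (by constructor <;> linarith) (hα x n) ?_ (by rw [hα0, hα0])
    intro t ht
    exact hα x m t ⟨by linarith [ht.1], by linarith [ht.2]⟩
  let Φ : ℝ × E → E := fun p => α p.2 ⌈|p.1|⌉₊ p.1
  have h3 : ∀ x (n : ℕ) (t : ℝ), |t| ≤ n → Φ (t, x) = α x n t := by
    intro x n t ht
    have h4 : |t| ≤ ⌈|t|⌉₊ := Nat.le_ceil _
    have h5 := abs_le.1 h4
    exact h2 x _ n (Nat.ceil_le.2 ht) ⟨by linarith [h5.1], by linarith [h5.2]⟩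
  have h0 : ∀ x, Φ (0, x) = x := by
    intro x; rw [h3 x 0 0 (by simp), hα0]
  have hd : ∀ x t, HasDerivAt (fun s => Φ (s, x)) (V (Φ (t, x))) t := by
    intro x t
    obtain ⟨n, hn⟩ := exists_nat_gt |t|
    have hn' := abs_lt.1 hn
    rw [h3 x n t hn.le]
    refine (hα x n t ⟨by linarith [hn'.1], by linarith [hn'.2]⟩).congr_of_eventuallyEq ?_
    have : ∀ᶠ s : ℝ in 𝓝 t, |s| < (n : ℝ) := (continuous_abs.tendsto t).eventually (gt_mem_nhds hn)
    filter_upwards [this] with s hs using h3 x n s hs.le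
  have hu : ∀ (f g : ℝ → E), (∀ t, HasDerivAt f (V (f t)) t) → (∀ t, HasDerivAt g (V (g t)) t) →
      f 0 = g 0 → f = g := by
    intro f g hf hg h
    exact ODE_solution_unique_univ (v := fun _ => V) (s := fun _ => univ) (K := K) (t₀ := 0)
      (fun _ => hK.lipschitzOnWith) (fun t => ⟨hf t, trivial⟩) (fun t => ⟨hg t, trivial⟩) h
  refine ⟨Φ, ?_, h0, ?_, hd⟩
  · rw [continuous_iff_continuousAt]
    rintro ⟨t₀, x₀⟩
    have hb : ∀ p : ℝ × E, dist (Φ p) (Φ (t₀, x₀)) ≤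
        L * ‖p.1 - t₀‖ + dist p.2 x₀ * Real.exp (K * |t₀|) := by
      rintro ⟨t, x⟩
      refine (dist_triangle _ (Φ (t₀, x)) _).trans (add_le_add ?_ ?_)
      · rw [dist_eq_norm]
        exact convex_univ.norm_image_sub_le_of_norm_hasDerivWithin_le (C := L)
          (f := fun s => Φ (s, x)) (fun s _ => (hd x s).hasDerivWithinAt) (fun s _ => hL _)
          trivial trivial
      · have := sol_dist hK (hd x) (hd x₀) t₀
        simpa [h0] using this
    rw [ContinuousAt, tendsto_iff_dist_tendsto_zero]
    refine squeeze_zero (fun _ => dist_nonneg) hb ?_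
    have : Continuous fun p : ℝ × E => L * ‖p.1 - t₀‖ + dist p.2 x₀ * Real.exp (K * |t₀|) := by
      fun_prop
    simpa using this.tendsto (t₀, x₀)
  · intro s t x
    have := hu (fun s => Φ (s + t, x)) (fun s => Φ (s, Φ (t, x)))
      (fun r => HasDerivAt.comp_add_const r t (hd x (r + t))) (hd _) (by simp [h0])
    exact congrFun this s

end flow

/-- barrier lemma -/
lemma barrier {v v' : ℝ → ℝ} {T K : ℝ} (hv : ∀ t ∈ Icc 0 T, HasDerivAt v (v' t) t)
    (hb : ∀ t ∈ Icc 0 T, |v' t| ≤ K * |v t|) (h0 : v 0 ≤ 0) : ∀ t ∈ Icc 0 T, v t ≤ 0 := by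
  intro t ht
  by_contra! h
  have hc : ContinuousOn v (Icc 0 t) := fun s hs =>
    (hv s ⟨hs.1, hs.2.trans ht.2⟩).continuousAt.continuousWithinAt
  obtain ⟨s, hs, hs0⟩ := intermediate_value_Icc ht.1 hc ⟨h0, h.le⟩
  have := eq_zero_of_abs_deriv_le_mul_abs_self_of_eq_zero_right (f := v) (f' := v') (K := K)
    (a := s) (b := t) (hc.mono (Icc_subset_Icc_left hs.1))
    (fun r hr => (hv r ⟨hs.1.trans hr.1, hr.2.le.trans ht.2⟩).hasDerivWithinAt) hs0
    (fun r hr => hb r ⟨hs.1.trans hr.1, hr.2.le.trans ht.2⟩) t ⟨hs.2, le_rfl⟩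
  linarith

lemma barrier' {v v' : ℝ → ℝ} {T K : ℝ} (hv : ∀ t ∈ Icc 0 T, HasDerivAt v (v' t) t)
    (hb : ∀ t ∈ Icc 0 T, |v' t| ≤ K * |v t|) (h0 : 0 ≤ v 0) : ∀ t ∈ Icc 0 T, 0 ≤ v t := by
  intro t ht
  have := barrier (v := fun t => - v t) (v' := fun t => - v' t) (K := K)
    (fun t ht => (hv t ht).neg) (by simpa using hb) (by simpa using h0) t ht
  simpa using this


open Real

noncomputable def sa (k : ℤ) : ℝ := if k % 2 = 0 then 0 else π / 4
noncomputable def sb (k : ℤ) : ℝ := if (k / 2) % 2 = 0 then 0 else π / 4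
noncomputable def dd (h : ℝ) : ℝ := max 0 (max (1 / 64 - h) (h - 49 / 64))
noncomputable def HH (k : ℤ) (x y : ℝ) : ℝ := sin (x - sa k) * sin (y - sb k)
noncomputable def U (k : ℤ) (p : ℝ × ℝ × ℝ) : ℝ × ℝ × ℝ :=
  (sin (2 * p.2.2) * (sin (p.1 - sa k) * cos (p.2.1 - sb k)),
   - (sin (2 * p.2.2) * (cos (p.1 - sa k) * sin (p.2.1 - sb k))),
   cos (2 * p.2.2) ^ 2 + sin (2 * p.2.2) ^ 2 * dd (HH k p.1 p.2.1 ^ 2))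
noncomputable def V (p : ℝ × ℝ × ℝ) : ℝ × ℝ × ℝ := U ⌊p.2.2 / π⌋ p

lemma dd_nonneg (h : ℝ) : 0 ≤ dd h := le_max_left _ _

lemma dd_le_one {h : ℝ} (h0 : 0 ≤ h) (h1 : h ≤ 1) : dd h ≤ 1 := by
  unfold dd
  refine max_le (by norm_num) (max_le (by linarith) (by linarith))

lemma dd_eq_zero {h : ℝ} : dd h = 0 ↔ 1 / 64 ≤ h ∧ h ≤ 49 / 64 := by
  unfold dd
  constructor
  · intro hh
    have h1 := le_max_right 0 (max (1 / 64 - h) (h - 49 / 64))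
    have h2 := le_max_left (1 / 64 - h) (h - 49 / 64)
    have h3 := le_max_right (1 / 64 - h) (h - 49 / 64)
    constructor <;> linarith
  · rintro ⟨h1, h2⟩
    exact max_eq_left (max_le (by linarith) (by linarith))

lemma dd_lip (h g : ℝ) : |dd h - dd g| ≤ |h - g| := by
  unfold dd
  refine (abs_max_sub_max_le_max _ _ _ _).trans (max_le (by simp) ?_)
  refine (abs_max_sub_max_le_max _ _ _ _).trans (max_le ?_ ?_)
  · rw [abs_sub_comm]; apply le_of_eq; congr 1; ring
  · apply le_of_eq; congr 1; ring

lemma abs_HH_le (k : ℤ) (x y : ℝ) : |HH k x y| ≤ 1 := by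
  unfold HH; rw [abs_mul]
  exact mul_le_one₀ (abs_sin_le_one _) (abs_nonneg _) (abs_sin_le_one _)

lemma HH_sq_le (k : ℤ) (x y : ℝ) : HH k x y ^ 2 ≤ 1 := by
  have := abs_HH_le k x y
  rw [← sq_abs]; exact pow_le_one₀ (abs_nonneg _) this

/-- Lipschitz and bounded by one. -/
def BL (C : ℝ) (f : ℝ × ℝ × ℝ → ℝ) : Prop :=
  (∀ p, |f p| ≤ 1) ∧ ∀ p q, |f p - f q| ≤ C * dist p q

lemma BL.mul {C D : ℝ} {f g : ℝ × ℝ × ℝ → ℝ} (hf : BL C f) (hg : BL D g) :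
    BL (C + D) (fun p => f p * g p) := by
  refine ⟨fun p => ?_, fun p q => ?_⟩
  · rw [abs_mul]; exact mul_le_one₀ (hf.1 p) (abs_nonneg _) (hg.1 p)
  · have : f p * g p - f q * g q = (f p - f q) * g p + f q * (g p - g q) := by ring
    rw [this, add_mul]
    refine (abs_add_le _ _).trans (add_le_add ?_ ?_)
    · rw [abs_mul]
      exact (mul_le_of_le_one_right (abs_nonneg _) (hg.1 p)).trans (hf.2 p q)
    · rw [abs_mul]
      exact (mul_le_of_le_one_left (abs_nonneg _) (hf.1 q)).trans (hg.2 p q)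

lemma BL.neg {C : ℝ} {f : ℝ × ℝ × ℝ → ℝ} (hf : BL C f) : BL C (fun p => - f p) := by
  refine ⟨fun p => by simpa using hf.1 p, fun p q => ?_⟩
  have := hf.2 p q
  rwa [abs_sub_comm, show f q - f p = - f p - - f q by ring] at this

lemma abs_cos_sub_cos_le' (x y : ℝ) : |cos x - cos y| ≤ |x - y| := by
  have := lipschitzWith_cos.dist_le_mul x y
  simpa [Real.dist_eq] using this

lemma BL_sin {C c d : ℝ} {l : ℝ × ℝ × ℝ → ℝ} (hl : ∀ p q, |l p - l q| ≤ dist p q) (hc : 0 ≤ c)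
    (hC : C = c) : BL C (fun p => sin (c * l p - d)) := by
  refine ⟨fun p => abs_sin_le_one _, fun p q => (abs_sin_sub_sin_le _ _).trans ?_⟩
  rw [show c * l p - d - (c * l q - d) = c * (l p - l q) by ring, abs_mul, abs_of_nonneg hc, hC]
  exact mul_le_mul_of_nonneg_left (hl p q) hc

lemma BL_cos {C c d : ℝ} {l : ℝ × ℝ × ℝ → ℝ} (hl : ∀ p q, |l p - l q| ≤ dist p q) (hc : 0 ≤ c)
    (hC : C = c) : BL C (fun p => cos (c * l p - d)) := by
  refine ⟨fun p => abs_cos_le_one _, fun p q => (abs_cos_sub_cos_le' _ _).trans ?_⟩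
  rw [show c * l p - d - (c * l q - d) = c * (l p - l q) by ring, abs_mul, abs_of_nonneg hc, hC]
  exact mul_le_mul_of_nonneg_left (hl p q) hc

lemma l1 (p q : ℝ × ℝ × ℝ) : |p.1 - q.1| ≤ dist p q := le_max_left _ _
lemma l2 (p q : ℝ × ℝ × ℝ) : |p.2.1 - q.2.1| ≤ dist p q :=
  (le_max_left (dist p.2.1 q.2.1) _).trans (le_max_right (dist p.1 q.1) _)
lemma l3 (p q : ℝ × ℝ × ℝ) : |p.2.2 - q.2.2| ≤ dist p q :=
  (le_max_right (dist p.2.1 q.2.1) _).trans (le_max_right (dist p.1 q.1) _)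

lemma dist_le3 {p q : ℝ × ℝ × ℝ} {C : ℝ} (h1 : |p.1 - q.1| ≤ C) (h2 : |p.2.1 - q.2.1| ≤ C)
    (h3 : |p.2.2 - q.2.2| ≤ C) : dist p q ≤ C :=
  max_le h1 (max_le h2 h3)

lemma U_lip (k : ℤ) (p q : ℝ × ℝ × ℝ) : dist (U k p) (U k q) ≤ 12 * dist p q := by
  have sx : BL 1 (fun p => sin (p.1 - sa k)) := by
    simpa using BL_sin (c := 1) (C := 1) (d := sa k) l1 (by norm_num) rfl
  have cx : BL 1 (fun p => cos (p.1 - sa k)) := by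
    simpa using BL_cos (c := 1) (C := 1) (d := sa k) l1 (by norm_num) rfl
  have sy : BL 1 (fun p => sin (p.2.1 - sb k)) := by
    simpa using BL_sin (c := 1) (C := 1) (d := sb k) l2 (by norm_num) rfl
  have cy : BL 1 (fun p => cos (p.2.1 - sb k)) := by
    simpa using BL_cos (c := 1) (C := 1) (d := sb k) l2 (by norm_num) rfl
  have sz : BL 2 (fun p => sin (2 * p.2.2)) := by
    simpa using BL_sin (c := 2) (C := 2) (d := 0) l3 (by norm_num) rfl
  have cz : BL 2 (fun p => cos (2 * p.2.2)) := by
    simpa using BL_cos (c := 2) (C := 2) (d := 0) l3 (by norm_num) rfl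
  have hH : BL 2 (fun p => HH k p.1 p.2.1) := by
    have := sx.mul sy; norm_num at this; exact this
  have hD : BL 4 (fun p => dd (HH k p.1 p.2.1 ^ 2)) := by
    have := hH.mul hH
    refine ⟨fun p => ?_, fun p q => (dd_lip _ _).trans ?_⟩
    · rw [abs_of_nonneg (dd_nonneg _)]; exact dd_le_one (sq_nonneg _) (HH_sq_le _ _ _)
    · have h := this.2 p q
      norm_num at h; simpa [sq] using h
  have h0 : 0 ≤ dist p q := dist_nonneg
  have a1 := (sz.mul (sx.mul cy)).2 p q
  have a2 := (sz.mul (cx.mul sy)).neg.2 p q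
  have a3 := (cz.mul cz).2 p q
  have a4 := ((sz.mul sz).mul hD).2 p q
  refine dist_le3 ?_ ?_ ?_
  · simp only [U]; refine a1.trans ?_; nlinarith
  · simp only [U]; refine a2.trans ?_; nlinarith
  · simp only [U, sq (cos _), sq (sin _)]
    rw [add_sub_add_comm]
    refine (abs_add_le _ _).trans ((add_le_add a3 a4).trans ?_)
    nlinarith

lemma sin_int (k : ℤ) : sin (2 * ((k : ℝ) * π)) = 0 := by
  rw [← mul_assoc]; exact_mod_cast sin_int_mul_pi (2 * k)

lemma U_border (k m : ℤ) (p : ℝ × ℝ × ℝ) :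
    dist (U k p) (0, 0, 1) ≤ 2 * |p.2.2 - m * π| := by
  have hs : |sin (2 * p.2.2)| ≤ 2 * |p.2.2 - m * π| := by
    have := abs_sin_sub_sin_le (2 * p.2.2) (2 * ((m : ℝ) * π))
    rw [sin_int, sub_zero, ← mul_sub, abs_mul, abs_of_pos (by norm_num : (0 : ℝ) < 2)] at this
    exact this
  have hs1 := abs_sin_le_one (2 * p.2.2)
  refine dist_le3 ?_ ?_ ?_
  · simp only [U, sub_zero, abs_mul]
    refine le_trans (mul_le_of_le_one_right (abs_nonneg _) ?_) hs
    exact mul_le_one₀ (abs_sin_le_one _) (abs_nonneg _) (abs_cos_le_one _)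
  · simp only [U, sub_zero, abs_mul, abs_neg]
    refine le_trans (mul_le_of_le_one_right (abs_nonneg _) ?_) hs
    exact mul_le_one₀ (abs_cos_le_one _) (abs_nonneg _) (abs_sin_le_one _)
  · simp only [U]
    have hd0 := dd_nonneg (HH k p.1 p.2.1 ^ 2)
    have hd1 := dd_le_one (sq_nonneg _) (HH_sq_le k p.1 p.2.1)
    set D := dd (HH k p.1 p.2.1 ^ 2)
    have e : cos (2 * p.2.2) ^ 2 + sin (2 * p.2.2) ^ 2 * D - 1
        = sin (2 * p.2.2) * (sin (2 * p.2.2) * (D - 1)) := by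
      rw [cos_sq']; ring
    rw [e, abs_mul]
    refine le_trans (mul_le_of_le_one_right (abs_nonneg _) ?_) hs
    rw [abs_mul]
    exact mul_le_one₀ hs1 (abs_nonneg _) (abs_le.2 ⟨by linarith, by linarith⟩)

lemma U_at_border (k m : ℤ) (p : ℝ × ℝ × ℝ) (h : p.2.2 = m * π) : U k p = (0, 0, 1) := by
  have := U_border k m p
  rw [h, sub_self, abs_zero, mul_zero] at this
  exact dist_le_zero.1 this

lemma V_eq {k : ℤ} {p : ℝ × ℝ × ℝ} (h1 : k * π ≤ p.2.2) (h2 : p.2.2 ≤ (k + 1) * π) :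
    V p = U k p := by
  rcases h2.lt_or_eq with h | h
  · have : ⌊p.2.2 / π⌋ = k := by
      rw [Int.floor_eq_iff]
      exact ⟨(le_div_iff₀ pi_pos).2 h1, (div_lt_iff₀ pi_pos).2 h⟩
    rw [V, this]
  · have h' : p.2.2 = ((k + 1 : ℤ) : ℝ) * π := by rw [h]; push_cast; ring
    rw [V, U_at_border _ _ _ h', U_at_border _ _ _ h']

lemma floor_slab (z : ℝ) : (⌊z / π⌋ : ℝ) * π ≤ z ∧ z < (⌊z / π⌋ + 1) * π :=
  ⟨(le_div_iff₀ pi_pos).1 (Int.floor_le _), (div_lt_iff₀ pi_pos).1 (Int.lt_floor_add_one _)⟩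

lemma V_lip_aux (p q : ℝ × ℝ × ℝ) (h : p.2.2 ≤ q.2.2) : dist (V p) (V q) ≤ 12 * dist p q := by
  have hp := floor_slab p.2.2
  have hq := floor_slab q.2.2
  rcases (Int.floor_le_floor (div_le_div_of_nonneg_right h pi_pos.le)).lt_or_eq with hlt | heq
  · set m := ⌊q.2.2 / π⌋ with hm
    have h1 : ((⌊p.2.2 / π⌋ : ℝ) + 1) ≤ m := by exact_mod_cast hlt
    have h2 : p.2.2 ≤ m * π := hp.2.le.trans (mul_le_mul_of_nonneg_right h1 pi_pos.le)
    have a := U_border ⌊p.2.2 / π⌋ m p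
    have b := U_border m m q
    rw [abs_of_nonpos (by linarith)] at a
    rw [abs_of_nonneg (by linarith [hq.1])] at b
    have c := l3 p q
    rw [abs_of_nonpos (by linarith)] at c
    have d := dist_triangle_right (V p) (V q) (0, 0, 1)
    have e : (0 : ℝ) ≤ dist p q := dist_nonneg
    have b' : dist (V q) (0, 0, 1) ≤ 2 * (q.2.2 - m * π) := b
    have a' : dist (V p) (0, 0, 1) ≤ 2 * -(p.2.2 - m * π) := a
    linarith
  · rw [V, V, heq]; exact U_lip _ _ _

lemma V_lip : LipschitzWith 12 V := by
  refine LipschitzWith.of_dist_le_mul fun p q => ?_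
  rcases le_total p.2.2 q.2.2 with h | h
  · exact V_lip_aux p q h
  · rw [dist_comm, dist_comm p]; exact V_lip_aux q p h

lemma V_bdd (p : ℝ × ℝ × ℝ) : ‖V p‖ ≤ (2 : ℝ≥0) := by
  have hd0 := dd_nonneg (HH ⌊p.2.2 / π⌋ p.1 p.2.1 ^ 2)
  have hd1 := dd_le_one (sq_nonneg _) (HH_sq_le ⌊p.2.2 / π⌋ p.1 p.2.1)
  rw [← dist_zero_right]
  refine dist_le3 ?_ ?_ ?_
  · simp only [V, U, Prod.fst_zero, sub_zero, abs_mul]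
    refine le_trans (mul_le_one₀ (abs_sin_le_one _) (by positivity)
      (mul_le_one₀ (abs_sin_le_one _) (abs_nonneg _) (abs_cos_le_one _))) (by norm_num)
  · simp only [V, U, Prod.fst_zero, Prod.snd_zero, sub_zero, abs_mul, abs_neg]
    refine le_trans (mul_le_one₀ (abs_sin_le_one _) (by positivity)
      (mul_le_one₀ (abs_cos_le_one _) (abs_nonneg _) (abs_sin_le_one _))) (by norm_num)
  · simp only [V, U, Prod.snd_zero, sub_zero]
    rw [abs_of_nonneg (by positivity)]
    have := sin_sq_add_cos_sq (2 * p.2.2)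
    have h3 := sq_nonneg (sin (2 * p.2.2))
    have h4 := sq_nonneg (cos (2 * p.2.2))
    push_cast
    nlinarith

lemma V_ne (p : ℝ × ℝ × ℝ) : V p ≠ 0 := by
  intro h
  simp only [V, U, Prod.mk_eq_zero] at h
  obtain ⟨h1, h2, h3⟩ := h
  set k := ⌊p.2.2 / π⌋
  have hd0 := dd_nonneg (HH k p.1 p.2.1 ^ 2)
  have hc : cos (2 * p.2.2) ^ 2 = 0 := by
    have : 0 ≤ sin (2 * p.2.2) ^ 2 * dd (HH k p.1 p.2.1 ^ 2) := by positivity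
    nlinarith [sq_nonneg (cos (2 * p.2.2))]
  have hs : sin (2 * p.2.2) ^ 2 = 1 := by rw [sin_sq, hc]; ring
  have hs0 : sin (2 * p.2.2) ≠ 0 := by intro h; rw [h] at hs; norm_num at hs
  rw [hc, hs] at h3
  have hD : dd (HH k p.1 p.2.1 ^ 2) = 0 := by linarith
  obtain ⟨d1, d2⟩ := dd_eq_zero.1 hD
  have e1 : sin (p.1 - sa k) * cos (p.2.1 - sb k) = 0 := by
    rcases mul_eq_zero.1 h1 with h | h
    · exact absurd h hs0
    · exact h
  have e2 : cos (p.1 - sa k) * sin (p.2.1 - sb k) = 0 := by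
    rcases mul_eq_zero.1 (neg_eq_zero.1 h2) with h | h
    · exact absurd h hs0
    · exact h
  unfold HH at d1 d2
  have f1 : sin (p.1 - sa k) ≠ 0 := by intro h; rw [h] at d1; norm_num at d1
  have f2 : sin (p.2.1 - sb k) ≠ 0 := by intro h; rw [h] at d1; norm_num at d1
  have g1 : cos (p.2.1 - sb k) = 0 := (mul_eq_zero.1 e1).resolve_left f1
  have g2 : cos (p.1 - sa k) = 0 := (mul_eq_zero.1 e2).resolve_right f2
  rw [mul_pow, sin_sq, sin_sq, g1, g2] at d2
  norm_num at d2

lemma sin_quarter (y : ℝ) : (1 / 8 ≤ sin y ^ 2 ∧ sin y ^ 2 ≤ 7 / 8) ∨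
    (1 / 8 ≤ sin (y - π / 4) ^ 2 ∧ sin (y - π / 4) ^ 2 ≤ 7 / 8) := by
  have h1 : sin y ^ 2 = 1 / 2 - cos (2 * y) / 2 := sin_sq_eq_half_sub y
  have h2 : sin (y - π / 4) ^ 2 = 1 / 2 - sin (2 * y) / 2 := by
    rw [sin_sq_eq_half_sub, show 2 * (y - π / 4) = 2 * y - π / 2 by ring, cos_sub_pi_div_two]
  rw [h1, h2]
  have := sin_sq_add_cos_sq (2 * y)
  set s := sin (2 * y)
  set c := cos (2 * y)
  rcases le_total (c ^ 2) (1 / 2) with h | h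
  · left; constructor <;> nlinarith
  · right; constructor <;> nlinarith

lemma prod_bound {a b : ℝ} (ha : 1 / 8 ≤ a ^ 2 ∧ a ^ 2 ≤ 7 / 8) (hb : 1 / 8 ≤ b ^ 2 ∧ b ^ 2 ≤ 7 / 8) :
    dd ((a * b) ^ 2) = 0 := by
  rw [dd_eq_zero, mul_pow]
  constructor <;> nlinarith [ha.1, ha.2, hb.1, hb.2]

lemma cover (k : ℤ) (x y : ℝ) : ∃ n : ℕ, n ≤ 3 ∧ dd (HH (k + n) x y ^ 2) = 0 := by
  have key : ∀ a b : Bool, ∃ n : ℕ, n ≤ 3 ∧ ((k + n) % 2 = if a then 0 else 1) ∧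
      ((k + n) / 2 % 2 = if b then 0 else 1) := by
    intro a b
    have hm : k % 4 = 0 ∨ k % 4 = 1 ∨ k % 4 = 2 ∨ k % 4 = 3 := by omega
    have : ∃ r : ℤ, 0 ≤ r ∧ r ≤ 3 ∧ (r % 2 = if a then 0 else 1) ∧ (r / 2 = if b then 0 else 1) := by
      refine ⟨(if a then 0 else 1) + 2 * (if b then 0 else 1), ?_⟩
      cases a <;> cases b <;> simp
    obtain ⟨r, h0, h3, h1, h2⟩ := this
    refine ⟨((r - k) % 4).toNat, by omega, ?_, ?_⟩
    · rw [← h1]; omega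
    · rw [← h2]; omega
  rcases sin_quarter x with hx | hx <;> rcases sin_quarter y with hy | hy
  · obtain ⟨n, h3, h1, h2⟩ := key true true
    refine ⟨n, h3, ?_⟩
    simp only [if_true] at h1 h2
    simp only [HH, sa, sb, h1, h2, if_true, sub_zero]; exact prod_bound hx hy
  · obtain ⟨n, h3, h1, h2⟩ := key true false
    refine ⟨n, h3, ?_⟩
    simp only [if_true, Bool.false_eq_true, if_false] at h1 h2
    simp only [HH, sa, sb, h1, h2, if_true, sub_zero, one_ne_zero, if_false]; exact prod_bound hx hy
  · obtain ⟨n, h3, h1, h2⟩ := key false true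
    refine ⟨n, h3, ?_⟩
    simp only [if_true, Bool.false_eq_true, if_false] at h1 h2
    simp only [HH, sa, sb, h1, h2, if_true, sub_zero, one_ne_zero, if_false]; exact prod_bound hx hy
  · obtain ⟨n, h3, h1, h2⟩ := key false false
    refine ⟨n, h3, ?_⟩
    simp only [Bool.false_eq_true, if_false] at h1 h2
    simp only [HH, sa, sb, h1, h2, one_ne_zero, if_false]; exact prod_bound hx hy

/-- integral curves -/
def Sol (γ : ℝ → ℝ × ℝ × ℝ) : Prop := ∀ t, HasDerivAt γ (V (γ t)) t

lemma Sol.d1 {γ : ℝ → ℝ × ℝ × ℝ} (h : Sol γ) (t : ℝ) :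
    HasDerivAt (fun s => (γ s).1) (V (γ t)).1 t :=
  (ContinuousLinearMap.fst ℝ ℝ (ℝ × ℝ)).hasFDerivAt.comp_hasDerivAt t (h t)

lemma Sol.ds {γ : ℝ → ℝ × ℝ × ℝ} (h : Sol γ) (t : ℝ) :
    HasDerivAt (fun s => (γ s).2) (V (γ t)).2 t :=
  (ContinuousLinearMap.snd ℝ ℝ (ℝ × ℝ)).hasFDerivAt.comp_hasDerivAt t (h t)

lemma Sol.d2 {γ : ℝ → ℝ × ℝ × ℝ} (h : Sol γ) (t : ℝ) :
    HasDerivAt (fun s => (γ s).2.1) (V (γ t)).2.1 t :=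
  (ContinuousLinearMap.fst ℝ ℝ ℝ).hasFDerivAt.comp_hasDerivAt t (h.ds t)

lemma Sol.d3 {γ : ℝ → ℝ × ℝ × ℝ} (h : Sol γ) (t : ℝ) :
    HasDerivAt (fun s => (γ s).2.2) (V (γ t)).2.2 t :=
  (ContinuousLinearMap.snd ℝ ℝ ℝ).hasFDerivAt.comp_hasDerivAt t (h.ds t)

lemma Sol.cont3 {γ : ℝ → ℝ × ℝ × ℝ} (h : Sol γ) : Continuous (fun s => (γ s).2.2) :=
  continuous_iff_continuousAt.2 fun t => (h.d3 t).continuousAt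

lemma Sol.mono {γ : ℝ → ℝ × ℝ × ℝ} (h : Sol γ) : Monotone (fun s => (γ s).2.2) := by
  refine monotone_of_hasDerivAt_nonneg h.d3 fun t => ?_
  simp only [V, U, Pi.zero_apply]
  have := dd_nonneg (HH ⌊(γ t).2.2 / π⌋ (γ t).1 (γ t).2.1 ^ 2)
  positivity

/-- the part of the curve on `[0, T]` lies in slab `k` -/
def InSlab (γ : ℝ → ℝ × ℝ × ℝ) (k : ℤ) (T : ℝ) : Prop :=
  ∀ t ∈ Icc 0 T, k * π ≤ (γ t).2.2 ∧ (γ t).2.2 ≤ (k + 1) * π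

lemma cell {u c : ℝ → ℝ} {a T : ℝ} (hu : ∀ t ∈ Icc 0 T, HasDerivAt u (c t * sin (u t - a)) t)
    (hc : ∀ t, |c t| ≤ 1) : ∀ t ∈ Icc 0 T, |u t - u 0| ≤ π := by
  obtain ⟨h1, h2⟩ := floor_slab (u 0 - a)
  set m := ⌊(u 0 - a) / π⌋
  have hb : ∀ (n : ℤ) (t : ℝ), |c t * sin (u t - a)| ≤ 1 * |u t - (a + n * π)| := by
    intro n t
    rw [abs_mul]
    refine mul_le_mul (hc t) ?_ (abs_nonneg _) zero_le_one
    have : |sin (u t - a)| = |sin (u t - (a + n * π))| := by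
      rw [show u t - (a + n * π) = (u t - a) - n * π by ring, sin_sub_int_mul_pi, abs_mul,
        abs_zpow, abs_neg, abs_one, one_zpow, one_mul]
    rw [this]; exact abs_sin_le_abs
  intro t ht
  have b1 := barrier' (v := fun t => u t - (a + m * π)) (K := 1)
    (fun t ht => (hu t ht).sub_const _) (fun t _ => hb m t) (by linarith) t ht
  have b2 := barrier (v := fun t => u t - (a + (m + 1 : ℤ) * π)) (K := 1)
    (fun t ht => (hu t ht).sub_const _) (fun t _ => hb (m + 1) t)
    (by push_cast; linarith) t ht
  push_cast at b2
  rw [abs_le]; constructor <;> linarith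

lemma slab_x {γ : ℝ → ℝ × ℝ × ℝ} (h : Sol γ) {k : ℤ} {T : ℝ} (hs : InSlab γ k T) :
    ∀ t ∈ Icc 0 T, |(γ t).1 - (γ 0).1| ≤ π := by
  refine cell (u := fun t => (γ t).1) (a := sa k)
    (c := fun t => sin (2 * (γ t).2.2) * cos ((γ t).2.1 - sb k)) ?_ ?_
  · intro t ht
    have := h.d1 t
    rw [V_eq (hs t ht).1 (hs t ht).2] at this
    convert this using 1
    simp only [U]; ring
  · intro t
    rw [abs_mul]; exact mul_le_one₀ (abs_sin_le_one _) (abs_nonneg _) (abs_cos_le_one _)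

lemma slab_y {γ : ℝ → ℝ × ℝ × ℝ} (h : Sol γ) {k : ℤ} {T : ℝ} (hs : InSlab γ k T) :
    ∀ t ∈ Icc 0 T, |(γ t).2.1 - (γ 0).2.1| ≤ π := by
  refine cell (u := fun t => (γ t).2.1) (a := sb k)
    (c := fun t => - (sin (2 * (γ t).2.2) * cos ((γ t).1 - sa k))) ?_ ?_
  · intro t ht
    have := h.d2 t
    rw [V_eq (hs t ht).1 (hs t ht).2] at this
    convert this using 1
    simp only [U]; ring
  · intro t
    rw [abs_neg, abs_mul]
    exact mul_le_one₀ (abs_sin_le_one _) (abs_nonneg _) (abs_cos_le_one _)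

lemma slab_H {γ : ℝ → ℝ × ℝ × ℝ} (h : Sol γ) {k : ℤ} {T : ℝ} (hs : InSlab γ k T) :
    ∀ t ∈ Icc 0 T, HH k (γ t).1 (γ t).2.1 = HH k (γ 0).1 (γ 0).2.1 := by
  have hd : ∀ t ∈ Icc 0 T, HasDerivAt (fun t => HH k (γ t).1 (γ t).2.1) 0 t := by
    intro t ht
    have e1 := h.d1 t
    have e2 := h.d2 t
    rw [V_eq (hs t ht).1 (hs t ht).2] at e1 e2
    have : HasDerivAt (fun t => HH k (γ t).1 (γ t).2.1) _ t := (e1.sub_const (sa k)).sin.mul (e2.sub_const (sb k)).sin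
    convert this using 1
    simp only [U]; ring
  exact constant_of_has_deriv_right_zero (fun t ht => (hd t ht).continuousAt.continuousWithinAt)
    (fun t ht => (hd t ⟨ht.1, ht.2.le⟩).hasDerivWithinAt)

lemma trapped {γ : ℝ → ℝ × ℝ × ℝ} (h : Sol γ) {k : ℤ} (h0 : (γ 0).2.2 = k * π)
    (hD : dd (HH k (γ 0).1 (γ 0).2.1 ^ 2) = 0) {T : ℝ} (hT : 0 ≤ T) :
    (γ T).2.2 ≠ k * π + π / 2 := by
  intro hm
  have hs : InSlab γ k T := by
    intro t ht
    have a1 := h.mono ht.1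
    have a2 := h.mono ht.2
    simp only at a1 a2
    constructor <;> nlinarith [pi_pos]
  have := barrier (v := fun t => (γ t).2.2 - (k * π + π / 4)) (T := T) (K := 2)
    (fun t _ => (h.d3 t).sub_const _) ?_ (by simp only [h0]; linarith [pi_pos]) T ⟨hT, le_rfl⟩
  · linarith [pi_pos]
  · intro t ht
    rw [V_eq (hs t ht).1 (hs t ht).2]
    simp only [U]
    rw [slab_H h hs t ht, hD, mul_zero, add_zero]
    have e : cos (2 * (γ t).2.2) = - sin (2 * ((γ t).2.2 - (k * π + π / 4))) := by
      rw [show 2 * ((γ t).2.2 - (k * π + π / 4)) = (2 * (γ t).2.2 - π / 2) - k * (2 * π) by ring,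
        sin_sub_int_mul_two_pi, sin_sub_pi_div_two, neg_neg]
    rw [e]
    set v := (γ t).2.2 - (k * π + π / 4)
    rw [neg_sq, sq, abs_mul]
    refine (mul_le_of_le_one_left (abs_nonneg _) (abs_sin_le_one _)).trans ?_
    refine abs_sin_le_abs.trans ?_
    rw [abs_mul]; norm_num

lemma mirror {γ : ℝ → ℝ × ℝ × ℝ} (h : Sol γ) {k : ℤ} (h0 : (γ 0).2.2 = k * π)
    {T : ℝ} (hT : 0 ≤ T) (hm : (γ T).2.2 = k * π + π / 2) :
    γ (2 * T) = ((γ 0).1, (γ 0).2.1, (k + 1) * π) := by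
  have hs : InSlab γ k T := by
    intro t ht
    have a1 := h.mono ht.1
    have a2 := h.mono ht.2
    simp only at a1 a2
    constructor <;> nlinarith [pi_pos]
  let η : ℝ → ℝ × ℝ × ℝ := fun s =>
    ((γ (2 * T - s)).1, (γ (2 * T - s)).2.1, (2 * k + 1) * π - (γ (2 * T - s)).2.2)
  have hη : ∀ s ∈ Icc T (2 * T), HasDerivAt η (V (η s)) s := by
    intro s hs'
    have hr : 2 * T - s ∈ Icc 0 T := ⟨by linarith [hs'.2], by linarith [hs'.1]⟩
    have i : HasDerivAt (fun s => 2 * T - s) (-1) s := by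
      simpa using (hasDerivAt_id s).const_sub (2 * T)
    obtain ⟨b1, b2⟩ := hs _ hr
    have e1 := (h.d1 (2 * T - s)).comp s i
    have e2 := (h.d2 (2 * T - s)).comp s i
    have e3 := ((h.d3 (2 * T - s)).comp s i).const_sub ((2 * k + 1) * π)
    have : HasDerivAt η _ s := e1.prodMk (e2.prodMk e3)
    convert this using 1
    rw [V_eq b1 b2, V_eq (k := k) (by simp only [η]; linarith) (by simp only [η]; linarith)]
    have es : sin (2 * ((2 * k + 1) * π - (γ (2 * T - s)).2.2)) = - sin (2 * (γ (2 * T - s)).2.2) := by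
      have := sin_int_mul_two_pi_sub (2 * (γ (2 * T - s)).2.2) (2 * k + 1)
      rw [← this]; congr 1; push_cast; ring
    have ec : cos (2 * ((2 * k + 1) * π - (γ (2 * T - s)).2.2)) = cos (2 * (γ (2 * T - s)).2.2) := by
      have := cos_int_mul_two_pi_sub (2 * (γ (2 * T - s)).2.2) (2 * k + 1)
      rw [← this]; congr 1; push_cast; ring
    simp only [U, η, es, ec]
    ext <;> simp
  have := ODE_solution_unique (v := fun _ => V) (K := 12) (a := T) (b := 2 * T) (f := γ) (g := η)
    (fun _ => V_lip) (fun t _ => (h t).continuousAt.continuousWithinAt)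
    (fun t _ => (h t).hasDerivWithinAt)
    (fun t ht => (hη t ht).continuousAt.continuousWithinAt)
    (fun t ht => (hη t ⟨ht.1, ht.2.le⟩).hasDerivWithinAt)
    (by
      have : 2 * T - T = T := by ring
      simp only [η, this]
      ext
      · rfl
      · rfl
      · simp only [hm]; ring) (x := 2 * T) ⟨by linarith, le_rfl⟩
  rw [this]
  simp only [η, sub_self, h0]
  ext
  · rfl
  · rfl
  · simp only; ring

lemma bound_border {Φ : ℝ × (ℝ × ℝ × ℝ) → ℝ × ℝ × ℝ} (h0 : ∀ x, Φ (0, x) = x)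
    (hadd : ∀ s t x, Φ (s + t, x) = Φ (s, Φ (t, x))) (hsol : ∀ x, Sol (fun t => Φ (t, x)))
    (n : ℕ) : ∀ (k : ℤ) (x y : ℝ), dd (HH (k + n) x y ^ 2) = 0 → ∀ t, 0 ≤ t →
      |(Φ (t, (x, y, k * π))).1 - x| ≤ π ∧ |(Φ (t, (x, y, k * π))).2.1 - y| ≤ π ∧
      (Φ (t, (x, y, k * π))).2.2 ≤ (k + n + 1) * π := by
  induction n with
  | zero =>
    intro k x y hD t ht
    set q : ℝ × ℝ × ℝ := (x, y, k * π) with hq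
    have hS := hsol q
    have hle : (Φ (t, q)).2.2 ≤ k * π + π / 2 := by
      by_contra! hlt
      obtain ⟨s, hs, hs'⟩ := intermediate_value_Icc ht hS.cont3.continuousOn
        (show (k * π + π / 2 : ℝ) ∈ Icc _ _ from
          ⟨by simp only [h0, hq]; linarith [pi_pos], hlt.le⟩)
      exact trapped hS (k := k) (by simp [h0, hq]) (by simpa [h0, hq] using hD) hs.1 hs'
    have hs : InSlab (fun t => Φ (t, q)) k t := by
      intro s hs
      have a1 := hS.mono hs.1
      have a2 := hS.mono hs.2
      simp only [h0] at a1 a2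
      have : q.2.2 = k * π := rfl
      constructor
      · simp only; linarith
      · simp only; linarith [pi_pos]
    have b1 := slab_x hS hs t ⟨ht, le_rfl⟩
    have b2 := slab_y hS hs t ⟨ht, le_rfl⟩
    simp only [h0] at b1 b2
    refine ⟨b1, b2, ?_⟩
    push_cast; linarith [pi_pos]
  | succ n ih =>
    intro k x y hD t ht
    set q : ℝ × ℝ × ℝ := (x, y, k * π) with hq
    have hS := hsol q
    have hin : (Φ (t, q)).2.2 ≤ (k + 1) * π → |(Φ (t, q)).1 - x| ≤ π ∧ |(Φ (t, q)).2.1 - y| ≤ π := by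
      intro hle
      have hs : InSlab (fun t => Φ (t, q)) k t := by
        intro s hs
        have a1 := hS.mono hs.1
        have a2 := hS.mono hs.2
        simp only [h0] at a1 a2
        have : q.2.2 = k * π := rfl
        constructor
        · simp only; linarith
        · simp only; linarith [pi_pos]
      have b1 := slab_x hS hs t ⟨ht, le_rfl⟩
      have b2 := slab_y hS hs t ⟨ht, le_rfl⟩
      simp only [h0] at b1 b2
      exact ⟨b1, b2⟩
    rcases le_or_gt (Φ (t, q)).2.2 ((k + 1) * π) with hle | hlt
    · refine ⟨(hin hle).1, (hin hle).2, hle.trans ?_⟩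
      push_cast
      have : (0 : ℝ) ≤ n := n.cast_nonneg
      exact mul_le_mul_of_nonneg_right (by linarith) pi_pos.le
    · obtain ⟨s, hs, hs'⟩ := intermediate_value_Icc ht hS.cont3.continuousOn
        (show (k * π + π / 2 : ℝ) ∈ Icc _ _ from
          ⟨by simp only [h0, hq]; linarith [pi_pos], by linarith [pi_pos]⟩)
      have hmir := mirror hS (k := k) (by simp [h0, hq]) hs.1 hs'
      simp only [h0] at hmir
      have hmir' : Φ (2 * s, q) = (x, y, ((k + 1 : ℤ) : ℝ) * π) := by
        rw [hmir]; push_cast; rfl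
      have hst : 2 * s ≤ t := by
        by_contra! hc
        have := hS.mono hc.le
        simp only [hmir] at this
        linarith
      have := ih (k + 1) x y (by rw [← hD]; push_cast; congr 3; ring) (t - 2 * s) (by linarith)
      rw [← hmir', ← hadd, sub_add_cancel] at this
      refine ⟨this.1, this.2.1, this.2.2.trans (le_of_eq ?_)⟩
      push_cast; ring

lemma bound_all {Φ : ℝ × (ℝ × ℝ × ℝ) → ℝ × ℝ × ℝ} (h0 : ∀ x, Φ (0, x) = x)
    (hadd : ∀ s t x, Φ (s + t, x) = Φ (s, Φ (t, x))) (hsol : ∀ x, Sol (fun t => Φ (t, x)))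
    (q : ℝ × ℝ × ℝ) (t : ℝ) (ht : 0 ≤ t) : dist (Φ (t, q)) q ≤ 5 * π := by
  have hS := hsol q
  have hpi := pi_pos
  obtain ⟨f1, f2⟩ := floor_slab q.2.2
  set k := ⌊q.2.2 / π⌋
  have hmono := hS.mono ht
  simp only [h0] at hmono
  have hin : ∀ t, 0 ≤ t → (Φ (t, q)).2.2 ≤ (k + 1) * π →
      |(Φ (t, q)).1 - q.1| ≤ π ∧ |(Φ (t, q)).2.1 - q.2.1| ≤ π := by
    intro t ht hle
    have hs : InSlab (fun t => Φ (t, q)) k t := by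
      intro s hs
      have a1 := hS.mono hs.1
      have a2 := hS.mono hs.2
      simp only [h0] at a1 a2
      constructor
      · simp only; linarith
      · simp only; linarith
    have b1 := slab_x hS hs t ⟨ht, le_rfl⟩
    have b2 := slab_y hS hs t ⟨ht, le_rfl⟩
    simp only [h0] at b1 b2
    exact ⟨b1, b2⟩
  rcases le_or_gt (Φ (t, q)).2.2 ((k + 1) * π) with hle | hlt
  · obtain ⟨b1, b2⟩ := hin t ht hle
    refine dist_le3 (by linarith) (by linarith) ?_
    rw [abs_of_nonneg (by linarith)]; linarith
  · obtain ⟨s, hs, hs'⟩ := intermediate_value_Icc ht hS.cont3.continuousOn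
      (show ((k + 1) * π : ℝ) ∈ Icc _ _ from ⟨by simp only [h0]; exact f2.le, hlt.le⟩)
    simp only at hs'
    obtain ⟨b1, b2⟩ := hin s hs.1 hs'.le
    obtain ⟨n, hn, hD⟩ := cover (k + 1) (Φ (s, q)).1 (Φ (s, q)).2.1
    have key := bound_border h0 hadd hsol n (k + 1) _ _ hD (t - s) (by linarith [hs.2])
    have e : ((Φ (s, q)).1, (Φ (s, q)).2.1, ((k + 1 : ℤ) : ℝ) * π) = Φ (s, q) := by
      ext
      · rfl
      · rfl
      · simp only [hs']; push_cast; rfl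
    rw [e, ← hadd, sub_add_cancel] at key
    obtain ⟨c1, c2, c3⟩ := key
    have hn' : (n : ℝ) ≤ 3 := by exact_mod_cast hn
    have hn2 : (n : ℝ) * π ≤ 3 * π := mul_le_mul_of_nonneg_right hn' hpi.le
    push_cast at c3
    rw [abs_le] at b1 b2 c1 c2
    refine dist_le3 (abs_le.2 ⟨by linarith, by linarith⟩) (abs_le.2 ⟨by linarith, by linarith⟩) ?_
    rw [abs_of_nonneg (by linarith)]; linarith

noncomputable def toP (v : EuclideanSpace ℝ (Fin 3)) : ℝ × ℝ × ℝ := (v 0, v 1, v 2)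
noncomputable def ofP (p : ℝ × ℝ × ℝ) : EuclideanSpace ℝ (Fin 3) := !₂[p.1, p.2.1, p.2.2]

lemma toP_ofP (p : ℝ × ℝ × ℝ) : toP (ofP p) = p := by simp [toP, ofP]
lemma ofP_toP (v : EuclideanSpace ℝ (Fin 3)) : ofP (toP v) = v := by
  ext i; fin_cases i <;> simp [toP, ofP]
lemma cont_toP : Continuous toP := by unfold toP; fun_prop
lemma cont_ofP : Continuous ofP := by
  unfold ofP
  refine (PiLp.continuous_toLp 2 _).comp (continuous_pi fun i => ?_)
  fin_cases i <;> simp <;> fun_prop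

lemma norm_ofP (p q : ℝ × ℝ × ℝ) {C : ℝ} (hC : 0 ≤ C) (h : dist p q ≤ C) :
    ‖ofP p - ofP q‖ ≤ 2 * C := by
  have a1 := (l1 p q).trans h
  have a2 := (l2 p q).trans h
  have a3 := (l3 p q).trans h
  rw [EuclideanSpace.norm_eq]
  refine Real.sqrt_le_iff.2 ⟨by linarith, ?_⟩
  simp only [Fin.sum_univ_three, ofP, PiLp.sub_apply, Real.norm_eq_abs]
  simp
  have b1 := sq_le_sq' (abs_le.1 a1).1 (abs_le.1 a1).2
  have b2 := sq_le_sq' (abs_le.1 a2).1 (abs_le.1 a2).2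
  have b3 := sq_le_sq' (abs_le.1 a3).1 (abs_le.1 a3).2
  nlinarith

end KR

/-- **Kuperberg–Reed** (solution to Ulam's Problem 110 from the Scottish Book):
there exists a rest-point free flow on `ℝ³` with uniformly bounded trajectories. -/
theorem kuperberg_reed_bounded_flow_no_rest_points :
    ∃ φ : ℝ × EuclideanSpace ℝ (Fin 3) → EuclideanSpace ℝ (Fin 3),
      Continuous φ ∧
      (∀ x : EuclideanSpace ℝ (Fin 3), φ (0, x) = x) ∧
      (∀ s t : ℝ, ∀ x : EuclideanSpace ℝ (Fin 3), φ (s + t, x) = φ (s, φ (t, x))) ∧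
      (∀ x : EuclideanSpace ℝ (Fin 3), ∃ t : ℝ, φ (t, x) ≠ x) ∧
      (∃ K : ℝ, 0 < K ∧ ∀ t : ℝ, ∀ x : EuclideanSpace ℝ (Fin 3), ‖φ (t, x) - x‖ ≤ K) := by
  obtain ⟨Φ, hc, h0, hadd, hd⟩ := KR.flow_exists KR.V 12 2 KR.V_lip KR.V_bdd
  have hpi := Real.pi_pos
  have hb : ∀ t q, dist (Φ (t, q)) q ≤ 5 * Real.pi := by
    intro t q
    rcases le_total 0 t with ht | ht
    · exact KR.bound_all h0 hadd hd q t ht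
    · have := KR.bound_all h0 hadd hd (Φ (t, q)) (-t) (by linarith)
      rwa [← hadd, neg_add_cancel, h0, dist_comm] at this
  refine ⟨fun p => KR.ofP (Φ (p.1, KR.toP p.2)), ?_, ?_, ?_, ?_, 2 * (5 * Real.pi),
    by positivity, ?_⟩
  · exact KR.cont_ofP.comp (hc.comp (continuous_fst.prodMk (KR.cont_toP.comp continuous_snd)))
  · intro x; simp only [h0, KR.ofP_toP]
  · intro s t x; simp only [KR.toP_ofP, hadd]
  · intro x
    by_contra! hrest
    have hconst : ∀ t, Φ (t, KR.toP x) = KR.toP x := by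
      intro t
      have := congrArg KR.toP (hrest t)
      simpa only [KR.toP_ofP] using this
    have h1 := hd (KR.toP x) 0
    simp only [hconst] at h1
    exact KR.V_ne _ (h1.unique (hasDerivAt_const _ _))
  · intro t x
    have := KR.norm_ofP _ _ (by positivity) (hb t (KR.toP x))
    rwa [KR.ofP_toP] at this
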